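/- arXiv:2601.03634 — 3 statements merged into one kernel-verified Lean document; each statement's English description precedes it below -/
import Mathlib

section
/- Let σ: ℝ → ℝ be a sigmoidal function as in the context and let L^σ(t) = (σ(t+1) − σ(t−1))/2. Then for every t ∈ ℝ, the series ∑_{j ∈ ℤ} L^σ(t − j) converges and equals 1. -/
open Filter MeasureTheory Asymptotics

/-- For a sigmoidal function σ with density L^σ(t) = (σ(t+1) - σ(t-1))/2,
for every t ∈ ℝ the series ∑_{j ∈ ℤ} L^σ(t - j) converges and equals 1. -/
theorem stmt_1 (σ : ℝ → ℝ) (γ : ℝ) (hγ : 0 < γ)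
    (hmeas : Measurable σ) (hmono : Monotone σ)
    (hbot : Tendsto σ atBot (nhds 0)) (htop : Tendsto σ atTop (nhds 1))
    (hσ1 : σ 1 < 1)
    (hodd : ∀ t : ℝ, σ (-t) - 1/2 = -(σ t - 1/2))
    (hsmooth : ContDiff ℝ 2 σ)
    (hconc : ConcaveOn ℝ (Set.Ici (0:ℝ)) σ)
    (hdecay : σ =O[atBot] fun t => |t| ^ (-1 - γ))
    (L : ℝ → ℝ) (hL : ∀ t, L t = (σ (t + 1) - σ (t - 1)) / 2) :
    ∀ t : ℝ, HasSum (fun j : ℤ => L (t - j)) 1 := by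
  intro t
  have hLnn : ∀ x, 0 ≤ L x := by
    intro x
    rw [hL]
    have := hmono (show x - 1 ≤ x + 1 by linarith)
    linarith
  have hA : ∀ c : ℝ, Tendsto (fun N : ℕ => σ (c - N)) atTop (nhds 0) := by
    intro c
    refine hbot.comp ?_
    simp only [sub_eq_add_neg]
    exact tendsto_atBot_add_const_left _ _
      (tendsto_neg_atTop_atBot.comp tendsto_natCast_atTop_atTop)
  have hB : ∀ c : ℝ, Tendsto (fun N : ℕ => σ (c + N)) atTop (nhds 1) := by
    intro c
    exact htop.comp (tendsto_atTop_add_const_left _ _ tendsto_natCast_atTop_atTop)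
  have h1 : HasSum (fun n : ℕ => L (t - ((n : ℤ) : ℝ))) ((σ (t + 1) + σ t) / 2) := by
    rw [hasSum_iff_tendsto_nat_of_nonneg (fun n => hLnn _)]
    have hs : ∀ N : ℕ, ∑ n ∈ Finset.range N, L (t - ((n : ℤ) : ℝ))
        = (σ (t + 1) + σ t - (σ (t + 1 - N) + σ (t - N))) / 2 := by
      intro N
      induction N with
      | zero => simp
      | succ k ih =>
        rw [Finset.sum_range_succ, ih, hL]
        push_cast
        rw [show t + 1 - ((k : ℝ) + 1) = t - k by ring,
          show t - ((k : ℝ) + 1) = t - k - 1 by ring,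
          show t - (k : ℝ) + 1 = t + 1 - k by ring]
        ring
    simp only [hs]
    have := (((hA (t + 1)).add (hA t)).const_sub (σ (t + 1) + σ t)).div_const 2
    simpa using this
  have h2 : HasSum (fun n : ℕ => L (t - ((-((n : ℤ) + 1) : ℤ) : ℝ)))
      (1 - (σ (t + 1) + σ t) / 2) := by
    rw [hasSum_iff_tendsto_nat_of_nonneg (fun n => hLnn _)]
    have hs : ∀ N : ℕ, ∑ n ∈ Finset.range N, L (t - ((-((n : ℤ) + 1) : ℤ) : ℝ))
        = (σ (t + 1 + N) + σ (t + N) - (σ (t + 1) + σ t)) / 2 := by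
      intro N
      induction N with
      | zero => simp
      | succ k ih =>
        rw [Finset.sum_range_succ, ih, hL]
        push_cast
        rw [show t - -((k : ℝ) + 1) + 1 = t + 1 + (k + 1) by ring,
          show t - -((k : ℝ) + 1) - 1 = t + k by ring,
          show t + ((k : ℝ) + 1) = t + 1 + k by ring]
        ring
    simp only [hs]
    have := (((hB (t + 1)).add (hB t)).sub_const (σ (t + 1) + σ t)).div_const 2
    convert this using 2
    ring
  have h3 := HasSum.of_nat_of_neg_add_one (f := fun j : ℤ => L (t - j)) h1 h2
  convert h3 using 1
  ring
end

section
/- Let σ: ℝ → ℝ be a sigmoidal function as in the context and let L^σ(t) = (σ(t+1) − σ(t−1))/2. Then L^σ is integrable on ℝ and ∫_ℝ L^σ(t) dt = 1. -/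
open Filter MeasureTheory Asymptotics

/-- For a sigmoidal function σ with density L^σ(t) = (σ(t+1) - σ(t-1))/2,
L^σ is integrable on ℝ and ∫_ℝ L^σ(t) dt = 1. -/
theorem stmt_2 (σ : ℝ → ℝ) (γ : ℝ) (hγ : 0 < γ)
    (hmeas : Measurable σ) (hmono : Monotone σ)
    (hbot : Tendsto σ atBot (nhds 0)) (htop : Tendsto σ atTop (nhds 1))
    (hσ1 : σ 1 < 1)
    (hodd : ∀ t : ℝ, σ (-t) - 1/2 = -(σ t - 1/2))
    (hsmooth : ContDiff ℝ 2 σ)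
    (hconc : ConcaveOn ℝ (Set.Ici (0:ℝ)) σ)
    (hdecay : σ =O[atBot] fun t => |t| ^ (-1 - γ))
    (L : ℝ → ℝ) (hL : ∀ t, L t = (σ (t + 1) - σ (t - 1)) / 2) :
    Integrable L ∧ ∫ t : ℝ, L t = 1 := by
  have hc : Continuous σ := hsmooth.continuous
  obtain ⟨G, hG⟩ : ∃ G : ℝ → ℝ, ∀ x, HasDerivAt G (σ x) x :=
    ⟨fun x => ∫ t in (0:ℝ)..x, σ t, fun x => hc.integral_hasStrictDerivAt 0 x |>.hasDerivAt⟩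
  have hF : ∀ t, HasDerivAt (fun t => (G (t + 1) - G (t - 1)) / 2) (L t) t := by
    intro t
    rw [hL]
    exact (((hG (t + 1)).comp_add_const t 1).sub ((hG (t - 1)).comp_sub_const t 1)).div_const 2
  have hbd : ∀ t, σ (t - 1) ≤ (G (t + 1) - G (t - 1)) / 2 ∧
      (G (t + 1) - G (t - 1)) / 2 ≤ σ (t + 1) := by
    intro t
    obtain ⟨c, hcm, hce⟩ := exists_hasDerivAt_eq_slope G σ (show t - 1 < t + 1 by linarith)
      (fun x _ => (hG x).continuousAt.continuousWithinAt) (fun x _ => hG x)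
    have h2 : t + 1 - (t - 1) = 2 := by ring
    rw [h2] at hce
    rw [← hce]
    exact ⟨hmono hcm.1.le, hmono hcm.2.le⟩
  have h0 : Tendsto (fun t => (G (t + 1) - G (t - 1)) / 2) atBot (nhds 0) :=
    tendsto_of_tendsto_of_tendsto_of_le_of_le
      (hbot.comp (tendsto_atBot_add_const_right atBot (-1 : ℝ) tendsto_id))
      (hbot.comp (tendsto_atBot_add_const_right atBot (1 : ℝ) tendsto_id))
      (fun t => (hbd t).1) (fun t => (hbd t).2)
  have h1 : Tendsto (fun t => (G (t + 1) - G (t - 1)) / 2) atTop (nhds 1) :=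
    tendsto_of_tendsto_of_tendsto_of_le_of_le
      (htop.comp (tendsto_atTop_add_const_right atTop (-1 : ℝ) tendsto_id))
      (htop.comp (tendsto_atTop_add_const_right atTop (1 : ℝ) tendsto_id))
      (fun t => (hbd t).1) (fun t => (hbd t).2)
  have hpos : ∀ t, 0 ≤ L t := by
    intro t
    rw [hL]
    have := hmono (show t - 1 ≤ t + 1 by linarith)
    linarith
  have hi1 : IntegrableOn L (Set.Ioi 0) :=
    integrableOn_Ioi_deriv_of_nonneg (hF 0).continuousAt.continuousWithinAt
      (fun x _ => hF x) (fun x _ => hpos x) h1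
  have heven : L ∘ Neg.neg = L := by
    funext t
    have e1 := hodd (t + 1)
    have e2 := hodd (t - 1)
    rw [show -(t + 1) = -t - 1 by ring] at e1
    rw [show -(t - 1) = -t + 1 by ring] at e2
    simp only [Function.comp, hL]
    linarith
  have hi2 : IntegrableOn L (Set.Iic 0) := by
    rw [integrableOn_Iic_iff_integrableOn_Iio]
    have h := ((Measure.measurePreserving_neg (volume : Measure ℝ)).integrableOn_comp_preimage
      (Homeomorph.neg ℝ).isClosedEmbedding.measurableEmbedding (f := L) (s := Set.Ioi 0)).2 hi1
    rw [heven] at h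
    simpa using h
  have hi : Integrable L := by
    rw [← integrableOn_univ, ← Set.Iic_union_Ioi (a := (0:ℝ))]
    exact hi2.union hi1
  refine ⟨hi, ?_⟩
  rw [integral_of_hasDerivAt_of_tendsto hF hi h0 h1]
  norm_num
end

section
/- Let σ: ℝ → ℝ be a sigmoidal function as in the context and let L^σ(t) = (σ(t+1) − σ(t−1))/2. Then the discrete absolute moment of order 0 of L^σ is finite: M₀(L^σ) := sup_{t ∈ ℝ} ∑_{j ∈ ℤ} |L^σ(t − j)| < ∞. -/
open Filter MeasureTheory Asymptotics

/-- For a sigmoidal function σ with density L^σ, the discrete absolute moment of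
order 0 is finite: sup_{t ∈ ℝ} ∑_{j ∈ ℤ} |L^σ(t - j)| < ∞. -/
theorem stmt_6 (σ : ℝ → ℝ) (γ : ℝ) (hγ : 0 < γ)
    (hmeas : Measurable σ) (hmono : Monotone σ)
    (hbot : Tendsto σ atBot (nhds 0)) (htop : Tendsto σ atTop (nhds 1))
    (hσ1 : σ 1 < 1)
    (hodd : ∀ t : ℝ, σ (-t) - 1/2 = -(σ t - 1/2))
    (hsmooth : ContDiff ℝ 2 σ)
    (hconc : ConcaveOn ℝ (Set.Ici (0:ℝ)) σ)
    (hdecay : σ =O[atBot] fun t => |t| ^ (-1 - γ))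
    (L : ℝ → ℝ) (hL : ∀ t, L t = (σ (t + 1) - σ (t - 1)) / 2) :
    ∃ M : ℝ, ∀ t : ℝ,
      Summable (fun j : ℤ => |L (t - j)|) ∧ ∑' j : ℤ, |L (t - j)| ≤ M := by
  have h0 : ∀ x, 0 ≤ σ x := fun x => hmono.le_of_tendsto hbot x
  have h1 : ∀ x, σ x ≤ 1 := fun x => hmono.ge_of_tendsto htop x
  refine ⟨1, fun t => ?_⟩
  have hnn : ∀ x, |L x| = (σ (x + 1) - σ (x - 1)) / 2 := by
    intro x
    rw [hL, abs_of_nonneg]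
    have := hmono (show x - 1 ≤ x + 1 by linarith)
    linarith
  have key : ∀ (a : ℤ) (n : ℕ), ∑ j ∈ Finset.Ico a (a + n), |L (t - j)|
      = ((σ (t - a + 1) + σ (t - a)) - (σ (t - a - n + 1) + σ (t - a - n))) / 2 := by
    intro a n
    induction n with
    | zero => simp
    | succ n ih =>
      have e : Finset.Ico a (a + (n + 1 : ℕ)) = insert (a + (n : ℤ)) (Finset.Ico a (a + n)) := by
        ext x
        simp only [Finset.mem_Ico, Finset.mem_insert]
        omega
      rw [e, Finset.sum_insert (by simp), ih, hnn]
      push_cast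
      rw [show t - ((a : ℝ) + n) + 1 = t - a - n + 1 by ring,
        show t - ((a : ℝ) + n) - 1 = t - a - (n + 1) by ring,
        show t - (a : ℝ) - (n + 1) + 1 = t - a - n by ring]
      ring
  have bd : ∀ S : Finset ℤ, ∑ j ∈ S, |L (t - j)| ≤ 1 := by
    intro S
    obtain ⟨b, hb⟩ := S.bddAbove
    obtain ⟨a, ha⟩ := S.bddBelow
    have hsub : S ⊆ Finset.Ico a (a + ((b + 1 - a).toNat : ℕ)) := by
      intro x hx
      have h2 := hb hx
      have h3 := ha hx
      rw [Finset.mem_Ico]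
      omega
    refine (Finset.sum_le_sum_of_subset_of_nonneg hsub (fun _ _ _ => abs_nonneg _)).trans ?_
    rw [key]
    have i1 := h1 (t - a + 1)
    have i2 := h1 (t - a)
    have i3 := h0 (t - a - ((b + 1 - a).toNat : ℕ) + 1)
    have i4 := h0 (t - a - ((b + 1 - a).toNat : ℕ))
    linarith
  exact ⟨summable_of_sum_le (fun _ => abs_nonneg _) bd,
    Real.tsum_le_of_sum_le (fun _ => abs_nonneg _) bd⟩
end
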